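/- arXiv:2207.03420 — 2 statements merged into one kernel-verified Lean document; each statement's English description precedes it below -/
import Mathlib

section
/- Let ω be a weight on ℝ₊ and 1 < p < ∞. If ω ∈ B_p(0) and ω ∈ B_p(∞), then D_0^{1,p}(ℝ₊,ω) = R^0_{p,ω}(0) ∩ R^∞_{p,ω}(0); that is, u ∈ D^{1,p}(ℝ₊,ω) is approximable by C_c^∞(ℝ₊) functions (with derivatives converging in L^p(ℝ₊,ω) and locally uniform convergence) exactly when u(t) = ∫_0^t u'(τ) dτ = −∫_t^∞ u'(τ) dτ for every t > 0. -/
open MeasureTheory Set Filter Topology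
open scoped NNReal ENNReal

noncomputable section

/-- A weight on `ℝ₊ = (0,∞)`: continuous and positive there. -/
def IsWeight (ω : ℝ → ℝ) : Prop :=
  ContinuousOn ω (Set.Ioi 0) ∧ ∀ t : ℝ, 0 < t → 0 < ω t

/-- Membership of the pair `(u, u')` in the weighted Dirichlet space
`D^{1,p}(ℝ₊, ω)`: `u'` is locally integrable on `(0,∞)`, `u` is locally
absolutely continuous with derivative `u'`, and `∫_0^∞ |u'|^p ω < ∞`. -/
def MemD (p : ℝ) (ω u u' : ℝ → ℝ) : Prop :=
  (∀ a b : ℝ, 0 < a → a < b → IntegrableOn u' (Set.Ioc a b)) ∧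
  (∀ a b : ℝ, 0 < a → a < b → u b - u a = ∫ τ in a..b, u' τ) ∧
  IntegrableOn (fun t => |u' t| ^ p * ω t) (Set.Ioi 0)

/-- `‖u'‖_{L^p(ℝ₊, ω)} = (∫_0^∞ |u'(t)|^p ω(t) dt)^{1/p}`. -/
def dNorm (p : ℝ) (ω u' : ℝ → ℝ) : ℝ :=
  (∫ t in Set.Ioi (0:ℝ), |u' t| ^ p * ω t) ^ (1 / p)

/-- The norm `‖u‖^{(a)} = |u(a)| + ‖u'‖_{L^p(ℝ₊, ω)}`. -/
def aNorm (p : ℝ) (ω : ℝ → ℝ) (a : ℝ) (u u' : ℝ → ℝ) : ℝ :=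
  |u a| + dNorm p ω u'

/-- `ω ∈ B_p(0)`: `∫_0^1 ω(t)^{-1/(p-1)} dt < ∞`. -/
def Bp0 (p : ℝ) (ω : ℝ → ℝ) : Prop :=
  IntegrableOn (fun t => ω t ^ (-1 / (p - 1))) (Set.Ioc (0:ℝ) 1)

/-- `ω ∈ B_p(∞)`: `∫_1^∞ ω(t)^{-1/(p-1)} dt < ∞`. -/
def BpInf (p : ℝ) (ω : ℝ → ℝ) : Prop :=
  IntegrableOn (fun t => ω t ^ (-1 / (p - 1))) (Set.Ioi (1:ℝ))

/-- `Ω^0_ω(t) = (∫_0^t ω(τ)^{-1/(p-1)} dτ)^{1-1/p}`. -/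
def Omega0 (p : ℝ) (ω : ℝ → ℝ) (t : ℝ) : ℝ :=
  (∫ τ in Set.Ioc (0:ℝ) t, ω τ ^ (-1 / (p - 1))) ^ (1 - 1 / p)

/-- `Ω^∞_ω(t) = (∫_t^∞ ω(τ)^{-1/(p-1)} dτ)^{1-1/p}`. -/
def OmegaInf (p : ℝ) (ω : ℝ → ℝ) (t : ℝ) : ℝ :=
  (∫ τ in Set.Ioi t, ω τ ^ (-1 / (p - 1))) ^ (1 - 1 / p)

/-- `R^0_{p,ω}(c)`: elements of `D^{1,p}(ℝ₊,ω)` with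
`u(t) = c + ∫_0^t u'(τ) dτ` for every `t > 0`. -/
def MemR0 (p : ℝ) (ω : ℝ → ℝ) (c : ℝ) (u u' : ℝ → ℝ) : Prop :=
  MemD p ω u u' ∧ ∀ t : ℝ, 0 < t →
    IntegrableOn u' (Set.Ioc 0 t) ∧ u t = c + ∫ τ in Set.Ioc (0:ℝ) t, u' τ

/-- `R^∞_{p,ω}(c)`: elements of `D^{1,p}(ℝ₊,ω)` with
`u(t) = c - ∫_t^∞ u'(τ) dτ` for every `t > 0`. -/
def MemRInf (p : ℝ) (ω : ℝ → ℝ) (c : ℝ) (u u' : ℝ → ℝ) : Prop :=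
  MemD p ω u u' ∧ ∀ t : ℝ, 0 < t →
    IntegrableOn u' (Set.Ioi t) ∧ u t = c - ∫ τ in Set.Ioi t, u' τ

/-- `D_0^{1,p}(ℝ₊,ω)`: elements of `D^{1,p}(ℝ₊,ω)` approximable by smooth
compactly supported functions on `(0,∞)`, with derivatives converging in
`L^p(ℝ₊,ω)` and locally uniform convergence on compact subsets of `(0,∞)`. -/
def MemD0 (p : ℝ) (ω u u' : ℝ → ℝ) : Prop :=
  MemD p ω u u' ∧
  ∃ φ : ℕ → ℝ → ℝ,
    (∀ n, ContDiff ℝ (⊤ : ℕ∞) (φ n) ∧ HasCompactSupport (φ n) ∧ tsupport (φ n) ⊆ Set.Ioi 0) ∧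
    Tendsto (fun n => ∫ t in Set.Ioi (0:ℝ), |deriv (φ n) t - u' t| ^ p * ω t)
      atTop (𝓝 0) ∧
    (∀ K : Set ℝ, K ⊆ Set.Ioi 0 → IsCompact K →
      TendstoUniformlyOn (fun n => φ n) u atTop K)

/-- The measure `ω(t) dt` on `(0,∞)`. -/
def weightMeasure (ω : ℝ → ℝ) : Measure ℝ :=
  (volume.restrict (Ioi 0)).withDensity fun t => ENNReal.ofReal (ω t)

lemma weightMeasure_absolutelyContinuous (ω : ℝ → ℝ) :
    weightMeasure ω ≪ volume.restrict (Ioi 0) :=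
  withDensity_absolutelyContinuous _ _

lemma IsWeight.aemeasurable_ofReal {ω : ℝ → ℝ} (hω : IsWeight ω) :
    AEMeasurable (fun t => ENNReal.ofReal (ω t)) (volume.restrict (Ioi 0)) :=
  (hω.1.aemeasurable measurableSet_Ioi).ennreal_ofReal

lemma IsWeight.integrable_weightMeasure_iff {ω : ℝ → ℝ} (hω : IsWeight ω) {g : ℝ → ℝ} :
    Integrable g (weightMeasure ω) ↔ IntegrableOn (fun t => g t * ω t) (Ioi 0) := by
  rw [weightMeasure, integrable_withDensity_iff_integrable_smul₀' hω.aemeasurable_ofReal (by simp)]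
  refine integrableOn_congr_fun (fun t ht => ?_) measurableSet_Ioi
  simp [ENNReal.toReal_ofReal (hω.2 t ht).le, mul_comm]

lemma IsWeight.integral_weightMeasure {ω : ℝ → ℝ} (hω : IsWeight ω) (g : ℝ → ℝ) :
    ∫ t, g t ∂weightMeasure ω = ∫ t in Ioi 0, g t * ω t := by
  rw [weightMeasure,
    integral_withDensity_eq_integral_toReal_smul₀ hω.aemeasurable_ofReal (by simp)]
  refine setIntegral_congr_fun measurableSet_Ioi fun t ht => ?_
  simp [ENNReal.toReal_ofReal (hω.2 t ht).le, mul_comm]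

lemma IsWeight.memLp_weightMeasure_iff {ω : ℝ → ℝ} (hω : IsWeight ω) {p : ℝ} (hp : 0 < p)
    {f : ℝ → ℝ} (hf : AEStronglyMeasurable f (volume.restrict (Ioi 0))) :
    MemLp f (ENNReal.ofReal p) (weightMeasure ω) ↔
      IntegrableOn (fun t => |f t| ^ p * ω t) (Ioi 0) := by
  rw [← integrable_norm_rpow_iff (hf.mono_ac (weightMeasure_absolutelyContinuous ω))
    (by simpa using hp) ENNReal.ofReal_ne_top, ENNReal.toReal_ofReal hp.le,
    hω.integrable_weightMeasure_iff]
  rfl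

lemma IsWeight.eLpNorm_weightMeasure {ω : ℝ → ℝ} (hω : IsWeight ω) {p : ℝ} (hp : 0 < p)
    {f : ℝ → ℝ} (hf : MemLp f (ENNReal.ofReal p) (weightMeasure ω)) :
    eLpNorm f (ENNReal.ofReal p) (weightMeasure ω) =
      ENNReal.ofReal ((∫ t in Ioi 0, |f t| ^ p * ω t) ^ (1 / p)) := by
  rw [hf.eLpNorm_eq_integral_rpow_norm (by simpa using hp) ENNReal.ofReal_ne_top,
    ENNReal.toReal_ofReal hp.le, hω.integral_weightMeasure, one_div]
  rfl

/-- Hölder's inequality against the dual weight `ω^{-1/(p-1)}`. -/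
lemma IsWeight.integrableOn_and_integral_abs_le {ω : ℝ → ℝ} (hω : IsWeight ω) {p : ℝ}
    (hp : 1 < p) (hσ : IntegrableOn (fun t => ω t ^ (-1 / (p - 1))) (Ioi 0)) {f : ℝ → ℝ}
    (hf : AEStronglyMeasurable f (volume.restrict (Ioi 0)))
    (hfi : IntegrableOn (fun t => |f t| ^ p * ω t) (Ioi 0)) :
    IntegrableOn f (Ioi 0) ∧
      ∫ t in Ioi 0, |f t| ≤ (∫ t in Ioi 0, |f t| ^ p * ω t) ^ (1 / p) *
        (∫ t in Ioi 0, ω t ^ (-1 / (p - 1))) ^ (1 - 1 / p) := by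
  have hp0 : 0 < p := by linarith
  have hp1 : 0 < p - 1 := by linarith
  have hpq : p.HolderConjugate (p.conjExponent) := Real.HolderConjugate.conjExponent hp
  set q := p.conjExponent with hq
  have hωm : AEMeasurable ω (volume.restrict (Ioi 0)) := hω.1.aemeasurable measurableSet_Ioi
  have eF : EqOn (fun t => ‖f t * ω t ^ (1 / p)‖ ^ p) (fun t => |f t| ^ p * ω t) (Ioi 0) := by
    intro t ht
    have h := hω.2 t ht
    simp only [Real.norm_eq_abs, abs_mul, abs_of_pos (Real.rpow_pos_of_pos h _)]
    rw [Real.mul_rpow (abs_nonneg _) (Real.rpow_nonneg h.le _), ← Real.rpow_mul h.le,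
      one_div_mul_cancel hp0.ne', Real.rpow_one]
  have eG : EqOn (fun t => ‖ω t ^ (-(1 / p))‖ ^ q) (fun t => ω t ^ (-1 / (p - 1))) (Ioi 0) := by
    intro t ht
    have h := hω.2 t ht
    simp only [Real.norm_eq_abs, abs_of_pos (Real.rpow_pos_of_pos h _)]
    rw [← Real.rpow_mul h.le]
    congr 1
    rw [hq, Real.conjExponent]
    field_simp
  have eFG : EqOn (fun t => (f t * ω t ^ (1 / p)) * ω t ^ (-(1 / p))) f (Ioi 0) := by
    intro t ht
    have h := hω.2 t ht
    simp only
    rw [mul_assoc, ← Real.rpow_add h]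
    simp
  have eFG' : EqOn (fun t => ‖f t * ω t ^ (1 / p)‖ * ‖ω t ^ (-(1 / p))‖) (fun t => |f t|)
      (Ioi 0) := by
    intro t ht
    simp only
    rw [← norm_mul, ← Real.norm_eq_abs]
    exact congrArg _ (eFG ht)
  have hF : MemLp (fun t => f t * ω t ^ (1 / p)) (ENNReal.ofReal p) (volume.restrict (Ioi 0)) := by
    have hFm : AEStronglyMeasurable (fun t => f t * ω t ^ (1 / p)) (volume.restrict (Ioi 0)) :=
      hf.mul (hωm.pow_const _).aestronglyMeasurable
    rw [← integrable_norm_rpow_iff hFm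
      (by simpa using hp0) ENNReal.ofReal_ne_top, ENNReal.toReal_ofReal hp0.le]
    exact (integrableOn_congr_fun eF measurableSet_Ioi).2 hfi
  have hG : MemLp (fun t => ω t ^ (-(1 / p))) (ENNReal.ofReal q) (volume.restrict (Ioi 0)) := by
    rw [← integrable_norm_rpow_iff (hωm.pow_const _).aestronglyMeasurable
      (by simpa using hpq.symm.pos) ENNReal.ofReal_ne_top, ENNReal.toReal_ofReal hpq.symm.pos.le]
    exact (integrableOn_congr_fun eG measurableSet_Ioi).2 hσ
  constructor
  · have : (ENNReal.ofReal p).HolderConjugate (ENNReal.ofReal q) := hpq.ennrealOfReal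
    exact (integrableOn_congr_fun eFG measurableSet_Ioi).1 (hF.integrable_mul hG)
  · have h := integral_mul_norm_le_Lp_mul_Lq hpq hF hG
    rw [setIntegral_congr_fun measurableSet_Ioi eFG', setIntegral_congr_fun measurableSet_Ioi eF,
      setIntegral_congr_fun measurableSet_Ioi eG] at h
    have hq1 : 1 / q = 1 - 1 / p := by
      have := hpq.inv_add_inv_eq_one
      simp only [one_div]; linarith
    rwa [hq1] at h

lemma IsWeight.isFiniteMeasure_restrict {ω : ℝ → ℝ} (hω : IsWeight ω) {K : Set ℝ}
    (hK : IsCompact K) (hK0 : K ⊆ Ioi 0) : IsFiniteMeasure ((weightMeasure ω).restrict K) := by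
  refine ⟨?_⟩
  rw [Measure.restrict_apply_univ, weightMeasure, withDensity_apply _ hK.measurableSet,
    Measure.restrict_restrict hK.measurableSet, inter_eq_left.2 hK0]
  exact ((hω.1.mono hK0).integrableOn_compact hK).lintegral_lt_top

lemma IsWeight.memLp_of_hasCompactSupport {ω : ℝ → ℝ} (hω : IsWeight ω) {p : ℝ≥0∞} {g : ℝ → ℝ}
    (hg : Continuous g) (hgc : HasCompactSupport g) (hg0 : tsupport g ⊆ Ioi 0) :
    MemLp g p (weightMeasure ω) := by
  have := hω.isFiniteMeasure_restrict hgc hg0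
  obtain ⟨C, hC⟩ := hgc.exists_bound_of_continuous hg
  have h : MemLp g p ((weightMeasure ω).restrict (tsupport g)) :=
    MemLp.of_bound hg.aestronglyMeasurable C (ae_of_all _ hC)
  rw [← memLp_indicator_iff_restrict (isClosed_tsupport g).measurableSet] at h
  rwa [indicator_eq_self.2 (subset_tsupport g)] at h

/-- Smooth cutoffs on `(0,∞)`, one on `[1/(n+1), n+1]` and vanishing off a compact subset. -/
lemma exists_smooth_cutoff (n : ℕ) :
    ∃ χ : ℝ → ℝ, ContDiff ℝ (⊤ : ℕ∞) χ ∧ HasCompactSupport χ ∧ tsupport χ ⊆ Ioi 0 ∧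
      (∀ t ∈ Icc (1 / ((n : ℝ) + 1)) (n + 1), χ t = 1) ∧ ∀ t, χ t ∈ Icc (0 : ℝ) 1 := by
  have hn : (0 : ℝ) < (n : ℝ) + 1 := by positivity
  set a := 1 / ((n : ℝ) + 1)
  have ha : 0 < a := by positivity
  obtain ⟨χ, h0, h1, h01⟩ := exists_contMDiffMap_zero_one_of_isClosed (n := ⊤)
    (modelWithCornersSelf ℝ ℝ) (s := (Ioo (a / 2) (n + 2))ᶜ) (t := Icc a (n + 1))
    isOpen_Ioo.isClosed_compl isClosed_Icc (by
      rw [disjoint_compl_left_iff_subset]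
      exact fun t ht => ⟨by linarith [ht.1], by linarith [ht.2]⟩)
  have hs : tsupport χ ⊆ Icc (a / 2) (n + 2) := by
    refine closure_minimal (fun t ht => ?_) isClosed_Icc
    by_contra hc
    exact ht (h0 fun h => hc (Ioo_subset_Icc_self h))
  exact ⟨χ, χ.contMDiff.contDiff, HasCompactSupport.of_support_subset_isCompact isCompact_Icc
    ((subset_tsupport _).trans hs), fun t ht => lt_of_lt_of_le (by positivity) (hs ht).1,
    fun t ht => h1 ht, h01⟩

lemma MeasureTheory.MemLp.exists_contDiff_eLpNorm_sub_le {μ : Measure ℝ} [IsFiniteMeasure μ]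
    {p : ℝ≥0∞} (hp : p ≠ ∞) (hp1 : 1 ≤ p) {f : ℝ → ℝ} (hf : MemLp f p μ) {ε : ℝ≥0∞} (hε : ε ≠ 0) :
    ∃ g : ℝ → ℝ, ContDiff ℝ (⊤ : ℕ∞) g ∧ eLpNorm (g - f) p μ ≤ ε := by
  have hε2 : ε / 2 ≠ 0 := by simpa using hε
  obtain ⟨g, hg, hgm⟩ := hf.exists_boundedContinuous_eLpNorm_sub_le hp hε2
  obtain ⟨δ, hδ, hδε⟩ : ∃ δ : ℝ, 0 < δ ∧
      μ univ ^ p.toReal⁻¹ * ENNReal.ofReal δ ≤ ε / 2 := by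
    have hc : μ univ ^ p.toReal⁻¹ ≠ ∞ := ENNReal.rpow_ne_top_of_nonneg (by positivity) (by simp)
    have hlim : Tendsto (fun δ : ℝ => μ univ ^ p.toReal⁻¹ * ENNReal.ofReal δ) (𝓝[>] 0) (𝓝 0) := by
      have h : Tendsto (fun δ : ℝ => μ univ ^ p.toReal⁻¹ * ENNReal.ofReal δ) (𝓝 0)
          (𝓝 (μ univ ^ p.toReal⁻¹ * ENNReal.ofReal 0)) :=
        ENNReal.Tendsto.const_mul (ENNReal.tendsto_ofReal tendsto_id) (Or.inr hc)
      simp only [ENNReal.ofReal_zero, mul_zero] at h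
      exact h.mono_left nhdsWithin_le_nhds
    obtain ⟨δ, h1, h2⟩ := ((hlim.eventually_le_const hε2.bot_lt).and self_mem_nhdsWithin).exists
    exact ⟨δ, h2, h1⟩
  obtain ⟨k, hk, hkd, -⟩ := g.continuous.exists_contDiff_approx ⊤ (ε := fun _ => δ)
    continuous_const fun _ => hδ
  refine ⟨k, hk, ?_⟩
  have h1 : eLpNorm (k - ⇑g) p μ ≤ ε / 2 :=
    (eLpNorm_le_of_ae_bound (ae_of_all _ fun t => (hkd t).le)).trans hδε
  have h2 : eLpNorm (⇑g - f) p μ ≤ ε / 2 := by rwa [eLpNorm_sub_comm]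
  calc eLpNorm (k - f) p μ = eLpNorm ((k - ⇑g) + (⇑g - f)) p μ := by rw [sub_add_sub_cancel]
    _ ≤ eLpNorm (k - ⇑g) p μ + eLpNorm (⇑g - f) p μ :=
        eLpNorm_add_le (hk.continuous.aestronglyMeasurable.sub hgm.1) (hgm.1.sub hf.1) hp1
    _ ≤ ε / 2 + ε / 2 := add_le_add h1 h2
    _ = ε := ENNReal.add_halves ε

/-- Test functions on `(0,∞)` are dense in `L^p(ℝ₊,ω)`. -/
lemma IsWeight.exists_test_eLpNorm_sub_le {ω : ℝ → ℝ} (hω : IsWeight ω) {p : ℝ} (hp : 1 ≤ p)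
    {f : ℝ → ℝ} (hf : MemLp f (ENNReal.ofReal p) (weightMeasure ω)) {ε : ℝ≥0∞} (hε : ε ≠ 0) :
    ∃ g : ℝ → ℝ, (ContDiff ℝ (⊤ : ℕ∞) g ∧ HasCompactSupport g ∧ tsupport g ⊆ Ioi 0) ∧
      eLpNorm (g - f) (ENNReal.ofReal p) (weightMeasure ω) ≤ ε := by
  have hp0 : 0 < p := by linarith
  have hP1 : 1 ≤ ENNReal.ofReal p := by simpa using hp
  have hε2 : ε / 2 ≠ 0 := by simpa using hε
  choose χ hχ hχc hχ0 hχ1 hχ01 using exists_smooth_cutoff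
  have hpos : ∀ᵐ t ∂weightMeasure ω, t ∈ Ioi (0 : ℝ) :=
    (weightMeasure_absolutelyContinuous ω).ae_le (ae_restrict_mem measurableSet_Ioi)
  have hbd : ∀ n t, ‖χ n t * f t - f t‖ ≤ ‖f t‖ := fun n t => by
    rw [show χ n t * f t - f t = (χ n t - 1) * f t by ring, norm_mul]
    refine mul_le_of_le_one_left (norm_nonneg _) ?_
    rw [Real.norm_eq_abs, abs_le]
    exact ⟨by linarith [(hχ01 n t).1], by linarith [(hχ01 n t).2]⟩
  have hm : ∀ n, AEStronglyMeasurable (fun t => χ n t * f t) (weightMeasure ω) := fun n =>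
    (hχ n).continuous.aestronglyMeasurable.mul hf.1
  have hsub : ∀ n, MemLp (fun t => χ n t * f t - f t) (ENNReal.ofReal p) (weightMeasure ω) :=
    fun n => hf.mono ((hm n).sub hf.1) (ae_of_all _ (hbd n))
  have hint : Integrable (fun t => ‖f t‖ ^ p) (weightMeasure ω) := by
    have := (integrable_norm_rpow_iff hf.1 (by simpa using hp0) ENNReal.ofReal_ne_top).2 hf
    rwa [ENNReal.toReal_ofReal hp0.le] at this
  have hlim : Tendsto (fun n => ∫ t, ‖χ n t * f t - f t‖ ^ p ∂weightMeasure ω) atTop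
      (𝓝 (∫ _, (0 : ℝ) ∂weightMeasure ω)) := by
    refine tendsto_integral_of_dominated_convergence _
      (fun n => ((hsub n).1.norm.aemeasurable.pow_const p).aestronglyMeasurable) hint
      (fun n => ae_of_all _ fun t => ?_) ?_
    · rw [Real.norm_of_nonneg (by positivity)]
      exact Real.rpow_le_rpow (norm_nonneg _) (hbd n t) hp0.le
    · filter_upwards [hpos] with t ht
      refine tendsto_const_nhds.congr' ?_
      have h1 : ∀ᶠ n : ℕ in atTop, 1 / ((n : ℝ) + 1) < t :=
        tendsto_one_div_add_atTop_nhds_zero_nat.eventually_lt_const ht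
      have h2 : ∀ᶠ n : ℕ in atTop, t ≤ n := tendsto_natCast_atTop_atTop.eventually_ge_atTop t
      filter_upwards [h1, h2] with n h1 h2
      rw [hχ1 n t ⟨h1.le, by linarith⟩]
      simp [Real.zero_rpow hp0.ne']
  have hlim' : Tendsto (fun n => eLpNorm (fun t => χ n t * f t - f t) (ENNReal.ofReal p)
      (weightMeasure ω)) atTop (𝓝 0) := by
    have h : Tendsto (fun n => ENNReal.ofReal
        ((∫ t, ‖χ n t * f t - f t‖ ^ p ∂weightMeasure ω) ^ p⁻¹)) atTop
        (𝓝 (ENNReal.ofReal ((∫ _, (0 : ℝ) ∂weightMeasure ω) ^ p⁻¹))) :=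
      ENNReal.tendsto_ofReal (hlim.rpow_const (Or.inr (by positivity)))
    simp only [integral_zero, Real.zero_rpow (inv_pos.2 hp0).ne', ENNReal.ofReal_zero] at h
    refine h.congr fun n => ?_
    rw [(hsub n).eLpNorm_eq_integral_rpow_norm (by simpa using hp0) ENNReal.ofReal_ne_top,
      ENNReal.toReal_ofReal hp0.le]
  obtain ⟨n, hn⟩ := (hlim'.eventually_le_const hε2.bot_lt).exists
  have := hω.isFiniteMeasure_restrict (hχc n) (hχ0 n)
  obtain ⟨k, hk, hkf⟩ := (hf.restrict (tsupport (χ n))).exists_contDiff_eLpNorm_sub_le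
    ENNReal.ofReal_ne_top hP1 hε2
  refine ⟨fun t => χ n t * k t, ⟨(hχ n).mul hk, (hχc n).mul_right,
    (tsupport_mul_subset_left).trans (hχ0 n)⟩, ?_⟩
  have hle : eLpNorm (fun t => χ n t * (k t - f t)) (ENNReal.ofReal p) (weightMeasure ω) ≤
      ε / 2 := by
    rw [← eLpNorm_indicator_eq_eLpNorm_restrict (isClosed_tsupport _).measurableSet] at hkf
    refine (eLpNorm_mono fun t => ?_).trans hkf
    by_cases ht : t ∈ tsupport (χ n)
    · rw [indicator_of_mem ht, norm_mul, Real.norm_of_nonneg (hχ01 n t).1]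
      exact mul_le_of_le_one_left (norm_nonneg _) (hχ01 n t).2
    · simp [image_eq_zero_of_notMem_tsupport ht]
  calc _ = eLpNorm ((fun t => χ n t * (k t - f t)) + fun t => χ n t * f t - f t)
        (ENNReal.ofReal p) (weightMeasure ω) := by
        congr 1; ext t; simp only [Pi.sub_apply, Pi.add_apply]; ring
    _ ≤ ε / 2 + ε / 2 := (eLpNorm_add_le ((hχ n).continuous.aestronglyMeasurable.mul
        (hk.continuous.aestronglyMeasurable.sub hf.1)) (hsub n).1 hP1).trans (add_le_add hle hn)
    _ = ε := ENNReal.add_halves ε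

lemma integrableOn_Ioi_of_Ioc_of_Ioi {f : ℝ → ℝ} (h0 : IntegrableOn f (Ioc 0 1))
    (h1 : IntegrableOn f (Ioi 1)) : IntegrableOn f (Ioi 0) := by
  rw [← Ioc_union_Ioi_eq_Ioi zero_le_one]
  exact h0.union h1

lemma aestronglyMeasurable_Ioi_of_integrableOn_Ioc {f : ℝ → ℝ}
    (hf : ∀ a b : ℝ, 0 < a → a < b → IntegrableOn f (Ioc a b)) :
    AEStronglyMeasurable f (volume.restrict (Ioi 0)) := by
  have hU : Ioi (0 : ℝ) ⊆ ⋃ n : ℕ, Ioc (1 / ((n : ℝ) + 1)) (n + 2) := fun t ht => by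
    have h1 : ∀ᶠ n : ℕ in atTop, 1 / ((n : ℝ) + 1) < t :=
      tendsto_one_div_add_atTop_nhds_zero_nat.eventually_lt_const ht
    have h2 : ∀ᶠ n : ℕ in atTop, t ≤ n := tendsto_natCast_atTop_atTop.eventually_ge_atTop t
    obtain ⟨n, h1, h2⟩ := (h1.and h2).exists
    exact mem_iUnion.2 ⟨n, h1, by linarith⟩
  refine AEStronglyMeasurable.mono_set hU (aestronglyMeasurable_iUnion_iff.2 fun n => ?_)
  have hn : (0 : ℝ) < (n : ℝ) + 1 := by positivity
  refine (hf _ _ (by positivity) ?_).aestronglyMeasurable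
  rw [div_lt_iff₀ hn]
  nlinarith [(Nat.cast_nonneg n : (0 : ℝ) ≤ n)]

/-- Convergence in `L^p(ℝ₊,ω)` implies convergence in `L^1(ℝ₊)`. -/
lemma IsWeight.tendsto_integral_abs_sub {ω : ℝ → ℝ} (hω : IsWeight ω) {p : ℝ} (hp : 1 < p)
    (hσ : IntegrableOn (fun t => ω t ^ (-1 / (p - 1))) (Ioi 0)) {f : ℝ → ℝ}
    (hf : AEStronglyMeasurable f (volume.restrict (Ioi 0)))
    (hfi : IntegrableOn (fun t => |f t| ^ p * ω t) (Ioi 0)) {g : ℕ → ℝ → ℝ}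
    (hg : ∀ n, Continuous (g n) ∧ HasCompactSupport (g n) ∧ tsupport (g n) ⊆ Ioi 0)
    (hlim : Tendsto (fun n => ∫ t in Ioi (0 : ℝ), |g n t - f t| ^ p * ω t) atTop (𝓝 0)) :
    Tendsto (fun n => ∫ t in Ioi (0 : ℝ), |g n t - f t|) atTop (𝓝 0) := by
  have hp0 : 0 < p := by linarith
  have hsub : ∀ n, IntegrableOn (fun t => |g n t - f t| ^ p * ω t) (Ioi 0) := fun n =>
    (hω.memLp_weightMeasure_iff hp0 ((hg n).1.aestronglyMeasurable.sub hf)).1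
      ((hω.memLp_of_hasCompactSupport (hg n).1 (hg n).2.1 (hg n).2.2).sub
        ((hω.memLp_weightMeasure_iff hp0 hf).2 hfi))
  have hle := fun n => (hω.integrableOn_and_integral_abs_le hp hσ
    ((hg n).1.aestronglyMeasurable.sub hf) (hsub n)).2
  refine squeeze_zero (fun n => integral_nonneg fun t => abs_nonneg _) hle ?_
  have h := (hlim.rpow_const (p := 1 / p) (Or.inr (by positivity))).mul_const
    ((∫ t in Ioi 0, ω t ^ (-1 / (p - 1))) ^ (1 - 1 / p))
  rwa [Real.zero_rpow (by positivity), zero_mul] at h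

lemma abs_setIntegral_sub_le_integral_Ioi {f g : ℝ → ℝ} (hf : IntegrableOn f (Ioi 0))
    (hg : IntegrableOn g (Ioi 0)) {s : Set ℝ} (hs : s ⊆ Ioi 0) :
    |(∫ t in s, g t) - ∫ t in s, f t| ≤ ∫ t in Ioi 0, |g t - f t| := by
  rw [← integral_sub (hg.mono_set hs) (hf.mono_set hs)]
  refine abs_integral_le_integral_abs.trans ?_
  exact setIntegral_mono_set (hg.sub hf).abs (ae_of_all _ fun t => abs_nonneg _)
    hs.eventuallyLE

/-- A test function on `(0,∞)` with zero mean is the derivative of a test function. -/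
lemma exists_test_antideriv {h : ℝ → ℝ} (hh : ContDiff ℝ (⊤ : ℕ∞) h) (hc : HasCompactSupport h)
    (h0 : tsupport h ⊆ Ioi 0) (hint : ∫ t in Ioi 0, h t = 0) :
    ∃ φ : ℝ → ℝ, (ContDiff ℝ (⊤ : ℕ∞) φ ∧ HasCompactSupport φ ∧ tsupport φ ⊆ Ioi 0) ∧
      deriv φ = h ∧ ∀ t, 0 < t → φ t = ∫ τ in Ioc 0 t, h τ := by
  have hderiv : ∀ t, HasDerivAt (fun t => ∫ τ in (0 : ℝ)..t, h τ) (h t) t := fun t =>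
    intervalIntegral.integral_hasDerivAt_right (hh.continuous.intervalIntegrable _ _)
      (hh.continuous.stronglyMeasurableAtFilter _ _) hh.continuous.continuousAt
  have hd : deriv (fun t => ∫ τ in (0 : ℝ)..t, h τ) = h := funext fun t => (hderiv t).deriv
  obtain ⟨a, b, ha, hab⟩ : ∃ a b : ℝ, 0 < a ∧ tsupport h ⊆ Icc a b := by
    rcases (tsupport h).eq_empty_or_nonempty with he | hne
    · exact ⟨1, 1, one_pos, by simp [he]⟩
    · obtain ⟨a, ha⟩ := hc.isCompact.exists_isLeast hne
      obtain ⟨b, hb⟩ := hc.isCompact.exists_isGreatest hne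
      exact ⟨a, b, h0 ha.1, fun t ht => ⟨ha.2 ht, hb.2 ht⟩⟩
  have hz : ∀ t ∉ Icc a b, h t = 0 := fun t ht =>
    image_eq_zero_of_notMem_tsupport fun h => ht (hab h)
  have hs : Function.support (fun t => ∫ τ in (0 : ℝ)..t, h τ) ⊆ Icc a b := by
    intro t ht
    by_contra hn
    refine ht ?_
    rcases lt_or_ge t a with hta | hta
    · refine intervalIntegral.integral_zero_ae (ae_of_all _ fun s hs => hz s fun hs' => ?_)
      rcases le_total 0 t with h | h
      · rw [uIoc_of_le h] at hs
        linarith [hs.2, hs'.1]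
      · rw [uIoc_of_ge h] at hs
        linarith [hs.2, hs'.1]
    · have hbt : b < t := not_le.1 fun h => hn ⟨hta, h⟩
      have ht0 : 0 < t := ha.trans_le hta
      simp only
      rw [intervalIntegral.integral_of_le ht0.le]
      refine (setIntegral_eq_of_subset_of_forall_sdiff_eq_zero measurableSet_Ioi
        Ioc_subset_Ioi_self fun s hs => hz s fun hs' => hs.2 ⟨hs.1, hs'.2.trans hbt.le⟩).symm.trans hint
  refine ⟨_, ⟨?_, HasCompactSupport.of_support_subset_isCompact isCompact_Icc hs,
    (closure_minimal hs isClosed_Icc).trans fun t ht => ha.trans_le ht.1⟩, hd, fun t ht =>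
    intervalIntegral.integral_of_le ht.le⟩
  rw [contDiff_infty_iff_deriv, hd]
  exact ⟨fun t => (hderiv t).differentiableAt, hh⟩

/-- Zero-mean elements of `L^p(ℝ₊,ω)` are limits of zero-mean test functions. -/
lemma IsWeight.exists_test_integral_eq_zero_tendsto {ω : ℝ → ℝ} (hω : IsWeight ω) {p : ℝ}
    (hp : 1 < p) (hσ : IntegrableOn (fun t => ω t ^ (-1 / (p - 1))) (Ioi 0)) {f : ℝ → ℝ}
    (hf : AEStronglyMeasurable f (volume.restrict (Ioi 0)))
    (hfi : IntegrableOn (fun t => |f t| ^ p * ω t) (Ioi 0)) (hf0 : ∫ t in Ioi 0, f t = 0) :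
    ∃ h : ℕ → ℝ → ℝ,
      (∀ n, ContDiff ℝ (⊤ : ℕ∞) (h n) ∧ HasCompactSupport (h n) ∧ tsupport (h n) ⊆ Ioi 0) ∧
      (∀ n, ∫ t in Ioi 0, h n t = 0) ∧
      Tendsto (fun n => ∫ t in Ioi (0 : ℝ), |h n t - f t| ^ p * ω t) atTop (𝓝 0) := by
  have hp0 : 0 < p := by linarith
  have hP1 : 1 ≤ ENNReal.ofReal p := by simpa using hp.le
  have hfm : MemLp f (ENNReal.ofReal p) (weightMeasure ω) :=
    (hω.memLp_weightMeasure_iff hp0 hf).2 hfi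
  have hfI : IntegrableOn f (Ioi 0) := (hω.integrableOn_and_integral_abs_le hp hσ hf hfi).1
  have eq_int : ∀ k : ℝ → ℝ, MemLp k (ENNReal.ofReal p) (weightMeasure ω) →
      ∫ t in Ioi (0 : ℝ), |k t| ^ p * ω t =
        (eLpNorm k (ENNReal.ofReal p) (weightMeasure ω)).toReal ^ p := fun k hk => by
    have hnn : 0 ≤ ∫ t in Ioi (0 : ℝ), |k t| ^ p * ω t :=
      setIntegral_nonneg measurableSet_Ioi fun t ht =>
        mul_nonneg (by positivity) (hω.2 t ht).le
    rw [hω.eLpNorm_weightMeasure hp0 hk, ENNReal.toReal_ofReal (by positivity),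
      ← Real.rpow_mul hnn, one_div_mul_cancel hp0.ne', Real.rpow_one]
  have tendsto_of : ∀ k : ℕ → ℝ → ℝ, (∀ n, MemLp (k n) (ENNReal.ofReal p) (weightMeasure ω)) →
      Tendsto (fun n => eLpNorm (k n) (ENNReal.ofReal p) (weightMeasure ω)) atTop (𝓝 0) →
      Tendsto (fun n => ∫ t in Ioi (0 : ℝ), |k n t| ^ p * ω t) atTop (𝓝 0) := fun k hk hl => by
    have h := ((ENNReal.tendsto_toReal ENNReal.zero_ne_top).comp hl).rpow_const
      (p := p) (Or.inr hp0.le)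
    rw [ENNReal.toReal_zero, Real.zero_rpow hp0.ne'] at h
    exact h.congr fun n => (eq_int _ (hk n)).symm
  choose g hg hgε using fun n : ℕ => hω.exists_test_eLpNorm_sub_le hp.le hfm
    (ε := (n : ℝ≥0∞)⁻¹) (by simp)
  have hgm : ∀ n, MemLp (g n) (ENNReal.ofReal p) (weightMeasure ω) := fun n =>
    hω.memLp_of_hasCompactSupport (hg n).1.continuous (hg n).2.1 (hg n).2.2
  have hgl : Tendsto (fun n => eLpNorm (g n - f) (ENNReal.ofReal p) (weightMeasure ω))
      atTop (𝓝 0) :=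
    tendsto_of_tendsto_of_tendsto_of_le_of_le tendsto_const_nhds
      ENNReal.tendsto_inv_nat_nhds_zero (fun _ => zero_le) hgε
  have hgL : Tendsto (fun n => ∫ t in Ioi (0 : ℝ), |g n t - f t|) atTop (𝓝 0) :=
    hω.tendsto_integral_abs_sub hp hσ hf hfi
      (fun n => ⟨(hg n).1.continuous, (hg n).2.1, (hg n).2.2⟩)
      (tendsto_of _ (fun n => (hgm n).sub hfm) hgl)
  have hgI : ∀ n, IntegrableOn (g n) (Ioi 0) := fun n =>
    ((hg n).1.continuous.integrable_of_hasCompactSupport (hg n).2.1).integrableOn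
  have hc : Tendsto (fun n => ∫ t in Ioi (0 : ℝ), g n t) atTop (𝓝 0) := by
    refine squeeze_zero_norm (fun n => ?_) hgL
    have h := abs_setIntegral_sub_le_integral_Ioi hfI (hgI n) subset_rfl
    rwa [hf0, sub_zero] at h
  obtain ⟨ψ, hψ, hψc, hψ0, hψ1⟩ : ∃ ψ : ℝ → ℝ, ContDiff ℝ (⊤ : ℕ∞) ψ ∧ HasCompactSupport ψ ∧
      tsupport ψ ⊆ Ioi 0 ∧ ∫ t in Ioi 0, ψ t = 1 := by
    let B : ContDiffBump (2 : ℝ) := ⟨1 / 2, 1, by norm_num, by norm_num⟩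
    have hB0 : tsupport (B.normed volume) ⊆ Ioi 0 := by
      rw [B.tsupport_normed_eq, Real.closedBall_eq_Icc]
      intro t ht
      have : (2 : ℝ) - 1 ≤ t := ht.1
      exact lt_of_lt_of_le (by norm_num) this
    refine ⟨B.normed volume, B.contDiff_normed, B.hasCompactSupport_normed, hB0, ?_⟩
    rw [setIntegral_eq_integral_of_forall_compl_eq_zero fun t ht =>
      image_eq_zero_of_notMem_tsupport fun h => ht (hB0 h), B.integral_normed]
  have hψm : MemLp ψ (ENNReal.ofReal p) (weightMeasure ω) :=
    hω.memLp_of_hasCompactSupport hψ.continuous hψc hψ0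
  have hψI : IntegrableOn ψ (Ioi 0) :=
    (hψ.continuous.integrable_of_hasCompactSupport hψc).integrableOn
  refine ⟨fun n t => g n t - (∫ s in Ioi 0, g n s) * ψ t, fun n => ⟨(hg n).1.sub
    (contDiff_const.mul hψ), (hg n).2.1.sub hψc.mul_left, ?_⟩, fun n => ?_, ?_⟩
  · exact (tsupport_sub _ _).trans (union_subset (hg n).2.2
      (tsupport_mul_subset_right.trans hψ0))
  · rw [integral_sub (hgI n) (hψI.const_mul _), integral_const_mul, hψ1, mul_one, sub_self]
  · refine tendsto_of _ (fun n => ((hgm n).sub (hψm.const_mul _)).sub hfm) ?_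
    have hbound : Tendsto (fun n => eLpNorm (g n - f) (ENNReal.ofReal p) (weightMeasure ω) +
        ‖∫ s in Ioi 0, g n s‖ₑ * eLpNorm ψ (ENNReal.ofReal p) (weightMeasure ω)) atTop (𝓝 0) := by
      have h := hgl.add (ENNReal.Tendsto.mul_const hc.enorm (Or.inr hψm.eLpNorm_ne_top))
      simpa using h
    refine tendsto_of_tendsto_of_tendsto_of_le_of_le tendsto_const_nhds hbound
      (fun _ => zero_le) fun n => ?_
    calc _ = eLpNorm ((g n - f) - (∫ s in Ioi 0, g n s) • ψ) (ENNReal.ofReal p)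
          (weightMeasure ω) := by
          congr 1; ext t; simp only [Pi.sub_apply, Pi.smul_apply, smul_eq_mul]; ring
      _ ≤ _ := by
          refine (eLpNorm_sub_le ((hgm n).1.sub hfm.1) (hψm.1.const_smul _) hP1).trans ?_
          rw [eLpNorm_const_smul]

/-- if `ω ∈ B_p(0)` and `ω ∈ B_p(∞)`, then
`D_0^{1,p}(ℝ₊,ω) = R^0_{p,ω}(0) ∩ R^∞_{p,ω}(0)`. -/
theorem stmt14 (p : ℝ) (ω : ℝ → ℝ) (hp : 1 < p) (hω : IsWeight ω)
    (h0 : Bp0 p ω) (hi : BpInf p ω) :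
    ∀ u u' : ℝ → ℝ, MemD p ω u u' →
      (MemD0 p ω u u' ↔ (MemR0 p ω 0 u u' ∧ MemRInf p ω 0 u u')) := by
  intro u u' hu
  have hσ : IntegrableOn (fun t => ω t ^ (-1 / (p - 1))) (Ioi 0) :=
    integrableOn_Ioi_of_Ioc_of_Ioi h0 hi
  have hm : AEStronglyMeasurable u' (volume.restrict (Ioi 0)) :=
    aestronglyMeasurable_Ioi_of_integrableOn_Ioc hu.1
  have hI : IntegrableOn u' (Ioi 0) :=
    (hω.integrableOn_and_integral_abs_le hp hσ hm hu.2.2).1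
  have hIoi : ∀ {t : ℝ}, 0 < t → Ioi t ⊆ Ioi 0 := fun ht => Ioi_subset_Ioi ht.le
  constructor
  · rintro ⟨-, φ, hφ, hlim, hunif⟩
    have hdt : ∀ n, tsupport (deriv (φ n)) ⊆ Ioi 0 := fun n =>
      tsupport_deriv_subset.trans (hφ n).2.2
    have hdc : ∀ n, Continuous (deriv (φ n)) := fun n => (hφ n).1.continuous_deriv (by simp)
    have hdI : ∀ n, Integrable (deriv (φ n)) := fun n =>
      (hdc n).integrable_of_hasCompactSupport (hφ n).2.1.deriv
    have hC1 : ∀ n, ContDiff ℝ 1 (φ n) := fun n => (hφ n).1.of_le (by simp)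
    have hL := hω.tendsto_integral_abs_sub hp hσ hm hu.2.2
      (fun n => ⟨hdc n, (hφ n).2.1.deriv, hdt n⟩) hlim
    have hset : ∀ s ⊆ Ioi (0 : ℝ), Tendsto (fun n => ∫ τ in s, deriv (φ n) τ) atTop
        (𝓝 (∫ τ in s, u' τ)) := fun s hs =>
      tendsto_iff_norm_sub_tendsto_zero.2 (squeeze_zero (fun n => norm_nonneg _)
        (fun n => abs_setIntegral_sub_le_integral_Ioi hI (hdI n).integrableOn hs) hL)
    have hpt : ∀ t, 0 < t → Tendsto (fun n => φ n t) atTop (𝓝 (u t)) := fun t ht =>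
      (hunif {t} (by simpa using ht) isCompact_singleton).tendsto_at (mem_singleton t)
    have hφ0 : ∀ n, φ n 0 = 0 := fun n =>
      image_eq_zero_of_notMem_tsupport fun h => lt_irrefl (0 : ℝ) ((hφ n).2.2 h)
    refine ⟨⟨hu, fun t ht => ⟨hI.mono_set Ioc_subset_Ioi_self, ?_⟩⟩,
      ⟨hu, fun t ht => ⟨hI.mono_set (hIoi ht), ?_⟩⟩⟩
    · rw [zero_add]
      refine tendsto_nhds_unique (hpt t ht) ((hset _ Ioc_subset_Ioi_self).congr fun n => ?_)
      rw [← intervalIntegral.integral_of_le ht.le, intervalIntegral.integral_deriv_eq_sub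
        (fun x _ => ((hC1 n).differentiable one_ne_zero) x) ((hdc n).intervalIntegrable _ _),
        hφ0, sub_zero]
    · rw [zero_sub]
      refine tendsto_nhds_unique (hpt t ht) ((hset _ (hIoi ht)).neg.congr fun n => ?_)
      rw [HasCompactSupport.integral_Ioi_deriv_eq (hC1 n) (hφ n).2.1, neg_neg]
  · rintro ⟨⟨-, hR0⟩, -, hRInf⟩
    have hmean : ∫ t in Ioi 0, u' t = 0 := by
      have h1 := (hR0 1 one_pos).2
      have h2 := (hRInf 1 one_pos).2
      rw [← Ioc_union_Ioi_eq_Ioi zero_le_one, setIntegral_union Ioc_disjoint_Ioi_same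
        measurableSet_Ioi (hR0 1 one_pos).1 (hRInf 1 one_pos).1]
      linarith
    obtain ⟨h, hh, hh0, hlim⟩ := hω.exists_test_integral_eq_zero_tendsto hp hσ hm hu.2.2 hmean
    choose φ hφ hφd hφi using fun n => exists_test_antideriv (hh n).1 (hh n).2.1 (hh n).2.2 (hh0 n)
    have hL := hω.tendsto_integral_abs_sub hp hσ hm hu.2.2
      (fun n => ⟨(hh n).1.continuous, (hh n).2.1, (hh n).2.2⟩) hlim
    refine ⟨hu, φ, hφ, by simpa only [hφd] using hlim, fun K hK _ => ?_⟩
    rw [Metric.tendstoUniformlyOn_iff]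
    intro ε hε
    filter_upwards [hL.eventually_lt_const hε] with n hn t ht
    rw [dist_comm, Real.dist_eq, hφi n t (hK ht), (hR0 t (hK ht)).2, zero_add]
    have hnI := (hh n).1.continuous.integrable_of_hasCompactSupport (hh n).2.1 (μ := volume)
    exact (abs_setIntegral_sub_le_integral_Ioi hI hnI.integrableOn Ioc_subset_Ioi_self).trans_lt hn

end
end

section
/- Let ω be a weight on ℝ₊ and 1 < p < ∞. Then R^∞_{p,ω}(0) is a closed subset of D^{1,p}(ℝ₊,ω) (closed with respect to the convergence: u_n' → u' in L^p(ℝ₊,ω) and u_n → u uniformly on compact subsets of ℝ₊) if and only if ω ∈ B_p(∞). -/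
open MeasureTheory Set Filter Topology
open scoped NNReal ENNReal

noncomputable section

lemma IsWeight.continuousOn_rpow {ω : ℝ → ℝ} (hω : IsWeight ω) (r : ℝ) :
    ContinuousOn (fun t => ω t ^ r) (Ioi 0) :=
  hω.1.rpow_const fun t ht => Or.inl (hω.2 t ht).ne'

lemma IsWeight.integrableOn_rpow_Ioc {ω : ℝ → ℝ} (hω : IsWeight ω) (r : ℝ) {a : ℝ} (ha : 0 < a)
    (b : ℝ) : IntegrableOn (fun t => ω t ^ r) (Ioc a b) :=
  (((hω.continuousOn_rpow r).mono fun _ hx => ha.trans_le hx.1).integrableOn_Icc).mono_set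
    Ioc_subset_Icc_self

lemma integrableOn_Ioi_of_integrableOn_Ioc {f : ℝ → ℝ} {a : ℝ}
    (h : ∀ t b : ℝ, 0 < t → IntegrableOn f (Ioc t b)) (hf : IntegrableOn f (Ioi a))
    {t : ℝ} (ht : 0 < t) : IntegrableOn f (Ioi t) := by
  refine ((h t a ht).union hf).mono_set fun x hx => ?_
  rcases le_or_gt x a with hxa | hxa
  · exact Or.inl ⟨hx, hxa⟩
  · exact Or.inr hxa

lemma MemD.aestronglyMeasurable {p : ℝ} {ω u u' : ℝ → ℝ} (h : MemD p ω u u') :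
    AEStronglyMeasurable u' (volume.restrict (Ioi 0)) := by
  have hU : Ioi (0 : ℝ) = ⋃ n : ℕ, Ioc (1 / ((n : ℝ) + 2)) ((n : ℝ) + 2) := by
    ext x
    simp only [mem_Ioi, mem_iUnion, mem_Ioc]
    constructor
    · intro hx
      obtain ⟨n, hn⟩ := exists_nat_gt (max x (1 / x))
      have hxn := (le_max_left _ _).trans_lt hn
      have hxn' := (le_max_right _ _).trans_lt hn
      refine ⟨n, ?_, by linarith⟩
      rw [div_lt_iff₀ (by positivity)]
      rw [div_lt_iff₀ hx] at hxn'
      nlinarith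
    · rintro ⟨n, hn, -⟩
      exact lt_trans (by positivity) hn
  rw [hU, aestronglyMeasurable_iUnion_iff]
  intro n
  refine (h.1 _ _ (by positivity) ?_).aestronglyMeasurable
  rw [div_lt_iff₀ (by positivity)]
  have : (0 : ℝ) ≤ n := n.cast_nonneg
  nlinarith

lemma norm_mul_weight_rpow {p : ℝ} {ω : ℝ → ℝ} (hp : 1 < p) (hω : IsWeight ω) (f : ℝ → ℝ)
    {t : ℝ} (ht : 0 < t) : ‖f t * ω t ^ (1 / p)‖ ^ p = |f t| ^ p * ω t := by
  have h := (hω.2 t ht).le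
  rw [norm_mul, Real.norm_eq_abs, Real.norm_of_nonneg (Real.rpow_nonneg h _),
    Real.mul_rpow (abs_nonneg _) (Real.rpow_nonneg h _), ← Real.rpow_mul h,
    one_div_mul_cancel (by positivity), Real.rpow_one]

lemma memLp_mul_weight_iff {p : ℝ} {ω f : ℝ → ℝ} (hp : 1 < p) (hω : IsWeight ω)
    (hf : AEStronglyMeasurable f (volume.restrict (Ioi 0))) :
    MemLp (fun t => f t * ω t ^ (1 / p)) (ENNReal.ofReal p) (volume.restrict (Ioi 0)) ↔
      IntegrableOn (fun t => |f t| ^ p * ω t) (Ioi 0) := by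
  have hp0 : 0 < p := by linarith
  have hm : AEStronglyMeasurable (fun t => f t * ω t ^ (1 / p)) (volume.restrict (Ioi 0)) :=
    hf.mul ((hω.continuousOn_rpow _).aestronglyMeasurable measurableSet_Ioi)
  rw [← integrable_norm_rpow_iff hm (by simpa using hp0) ENNReal.ofReal_ne_top,
    ENNReal.toReal_ofReal hp0.le]
  exact integrableOn_congr_fun (fun t ht => norm_mul_weight_rpow hp hω f ht) measurableSet_Ioi

lemma MemD.integrableOn_sub {p : ℝ} {ω u u' v v' : ℝ → ℝ} (hp : 1 < p) (hω : IsWeight ω)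
    (hu : MemD p ω u u') (hv : MemD p ω v v') :
    IntegrableOn (fun t => |u' t - v' t| ^ p * ω t) (Ioi 0) := by
  have h := ((memLp_mul_weight_iff hp hω hu.aestronglyMeasurable).2 hu.2.2).sub
    ((memLp_mul_weight_iff hp hω hv.aestronglyMeasurable).2 hv.2.2)
  refine (memLp_mul_weight_iff hp hω (hu.aestronglyMeasurable.sub hv.aestronglyMeasurable)).1 ?_
  convert h using 2
  simp [sub_mul]

/-- Hölder's inequality against the weight. -/
lemma integrableOn_Ioi_and_abs_integral_le {p : ℝ} {ω f : ℝ → ℝ} (hp : 1 < p) (hω : IsWeight ω)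
    (hf : AEStronglyMeasurable f (volume.restrict (Ioi 0)))
    (hfp : IntegrableOn (fun t => |f t| ^ p * ω t) (Ioi 0)) {t : ℝ} (ht : 0 < t)
    (hσ : IntegrableOn (fun s => ω s ^ (-1 / (p - 1))) (Ioi t)) :
    IntegrableOn f (Ioi t) ∧ |∫ s in Ioi t, f s| ≤ dNorm p ω f * OmegaInf p ω t := by
  have hp0 : 0 < p := by linarith
  have hp1 : 0 < p - 1 := by linarith
  have hpq : p.HolderConjugate (Real.conjExponent p) := .conjExponent hp
  have hq0 : 0 < Real.conjExponent p := hpq.symm.pos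
  have hsub : Ioi t ⊆ Ioi (0 : ℝ) := Ioi_subset_Ioi ht.le
  have hmono : volume.restrict (Ioi t) ≤ volume.restrict (Ioi (0 : ℝ)) :=
    Measure.restrict_mono hsub le_rfl
  have hF := ((memLp_mul_weight_iff hp hω hf).2 hfp).mono_measure hmono
  have hqσ : ∀ s ∈ Ioi t, (ω s ^ (-(1 / p))) ^ Real.conjExponent p = ω s ^ (-1 / (p - 1)) := by
    intro s hs
    rw [← Real.rpow_mul (hω.2 s (hsub hs)).le]
    congr 1
    rw [Real.conjExponent]
    field_simp
  have hG : MemLp (fun s => ω s ^ (-(1 / p))) (ENNReal.ofReal (Real.conjExponent p))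
      (volume.restrict (Ioi t)) := by
    rw [← integrable_norm_rpow_iff (((hω.continuousOn_rpow _).mono hsub).aestronglyMeasurable
      measurableSet_Ioi) (by simpa using hq0) ENNReal.ofReal_ne_top, ENNReal.toReal_ofReal hq0.le]
    refine (integrableOn_congr_fun (fun s hs => ?_) measurableSet_Ioi).2 hσ
    rw [← hqσ s hs, Real.norm_of_nonneg (Real.rpow_nonneg (hω.2 s (hsub hs)).le _)]
  have hfg : ∀ s ∈ Ioi t, ‖f s * ω s ^ (1 / p)‖ * ω s ^ (-(1 / p)) = |f s| := by
    intro s hs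
    have h := hω.2 s (hsub hs)
    rw [norm_mul, Real.norm_of_nonneg (Real.rpow_nonneg h.le _), mul_assoc, ← Real.rpow_add h,
      add_neg_cancel, Real.rpow_zero, mul_one, Real.norm_eq_abs]
  have : ENNReal.HolderTriple (ENNReal.ofReal p) (ENNReal.ofReal (Real.conjExponent p)) 1 := by
    simpa using hpq.ennrealOfReal
  have hint : IntegrableOn f (Ioi t) := by
    refine (integrable_norm_iff (hf.mono_measure hmono)).1 ?_
    refine (integrableOn_congr_fun hfg measurableSet_Ioi).1 ?_
    exact memLp_one_iff_integrable.1 (hG.mul hF.norm)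
  refine ⟨hint, (abs_integral_le_integral_abs).trans ?_⟩
  rw [← setIntegral_congr_fun measurableSet_Ioi hfg]
  refine (integral_mul_le_Lp_mul_Lq_of_nonneg hpq (.of_forall fun _ => norm_nonneg _) ?_
    hF.norm hG).trans ?_
  · filter_upwards [ae_restrict_mem measurableSet_Ioi] with s hs
    exact Real.rpow_nonneg (hω.2 s (hsub hs)).le _
  rw [setIntegral_congr_fun measurableSet_Ioi hqσ,
    setIntegral_congr_fun measurableSet_Ioi fun s hs => norm_mul_weight_rpow hp hω f (hsub hs)]
  have hexp : 1 / Real.conjExponent p = 1 - 1 / p := by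
    rw [Real.conjExponent]
    field_simp
  have hnn : ∀ s ∈ Ioi (0 : ℝ), 0 ≤ |f s| ^ p * ω s := fun s hs =>
    mul_nonneg (Real.rpow_nonneg (abs_nonneg _) _) (hω.2 s hs).le
  rw [hexp, dNorm, OmegaInf]
  refine mul_le_mul_of_nonneg_right (Real.rpow_le_rpow ?_ ?_ (by positivity)) ?_
  · exact setIntegral_nonneg measurableSet_Ioi fun s hs => hnn s (hsub hs)
  · refine setIntegral_mono_set hfp ?_ (.of_forall hsub)
    filter_upwards [ae_restrict_mem measurableSet_Ioi] with s hs using hnn s hs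
  · exact Real.rpow_nonneg (setIntegral_nonneg measurableSet_Ioi fun s hs =>
      Real.rpow_nonneg (hω.2 s (hsub hs)).le _) _

lemma memRInf_of_tendsto {p : ℝ} {ω : ℝ → ℝ} (hp : 1 < p) (hω : IsWeight ω) (hB : BpInf p ω)
    {u u' : ℕ → ℝ → ℝ} {v v' : ℝ → ℝ} {c : ℝ} (hu : ∀ n, MemRInf p ω c (u n) (u' n))
    (hv : MemD p ω v v')
    (hLp : Tendsto (fun n => ∫ t in Ioi (0 : ℝ), |u' n t - v' t| ^ p * ω t) atTop (𝓝 0))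
    (huv : ∀ t : ℝ, 0 < t → Tendsto (fun n => u n t) atTop (𝓝 (v t))) :
    MemRInf p ω c v v' := by
  refine ⟨hv, fun t ht => ?_⟩
  have hσ : IntegrableOn (fun s => ω s ^ (-1 / (p - 1))) (Ioi t) :=
    integrableOn_Ioi_of_integrableOn_Ioc (fun a b ha => hω.integrableOn_rpow_Ioc _ ha b)
      hB ht
  have hvint :=
    (integrableOn_Ioi_and_abs_integral_le hp hω hv.aestronglyMeasurable hv.2.2 ht hσ).1
  refine ⟨hvint, tendsto_nhds_unique (huv t ht) ?_⟩
  have hnorm : Tendsto (fun n => dNorm p ω (fun s => u' n s - v' s) * OmegaInf p ω t)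
      atTop (𝓝 0) := by
    have hpos : 0 < 1 / p := by positivity
    have := (hLp.rpow_const (p := 1 / p) (Or.inr hpos.le)).mul_const (OmegaInf p ω t)
    rwa [Real.zero_rpow hpos.ne', zero_mul] at this
  have hdiff : Tendsto (fun n => ∫ s in Ioi t, (u' n s - v' s)) atTop (𝓝 0) :=
    squeeze_zero_norm (fun n => (integrableOn_Ioi_and_abs_integral_le hp hω
      ((hu n).1.aestronglyMeasurable.sub hv.aestronglyMeasurable)
      ((hu n).1.integrableOn_sub hp hω hv) ht hσ).2) hnorm
  have hlim := hdiff.const_sub (c - ∫ s in Ioi t, v' s)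
  rw [sub_zero] at hlim
  refine hlim.congr fun n => ?_
  rw [((hu n).2 t ht).2, integral_sub ((hu n).2 t ht).1 hvint]
  ring

lemma memRInf_of_integrable {p : ℝ} {ω f : ℝ → ℝ} (c : ℝ) (hf : Integrable f)
    (hfp : IntegrableOn (fun t => |f t| ^ p * ω t) (Ioi 0)) :
    MemRInf p ω c (fun t => c - ∫ s in Ioi t, f s) f := by
  refine ⟨⟨fun _ _ _ _ => hf.integrableOn, fun a b _ hab => ?_, hfp⟩,
    fun _ _ => ⟨hf.integrableOn, rfl⟩⟩
  rw [← intervalIntegral.integral_Ioi_sub_Ioi hf.integrableOn hab.le]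
  ring

lemma exists_le_integral_of_not_bpInf {p : ℝ} {ω : ℝ → ℝ} (hω : IsWeight ω) (hB : ¬ BpInf p ω)
    {a : ℝ} (ha : 0 < a) (C : ℝ) : ∃ b, C < ∫ t in Ioc a b, ω t ^ (-1 / (p - 1)) := by
  by_contra! h
  have hloc : ∀ t b : ℝ, 0 < t → IntegrableOn (fun t => ω t ^ (-1 / (p - 1))) (Ioc t b) :=
    fun t b ht => hω.integrableOn_rpow_Ioc _ ht b
  refine hB (integrableOn_Ioi_of_integrableOn_Ioc (a := a) hloc ?_ one_pos)
  refine integrableOn_Ioi_of_intervalIntegral_norm_bounded C a (fun b => hloc a b ha)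
    tendsto_id ?_
  filter_upwards [eventually_ge_atTop a] with b hab
  rw [intervalIntegral.integral_of_le hab]
  refine le_of_eq_of_le (setIntegral_congr_fun measurableSet_Ioc fun t ht => ?_) (h b)
  exact Real.norm_of_nonneg (Real.rpow_nonneg (hω.2 t (ha.trans ht.1)).le _)

/-- If `ω ∉ B_p(∞)`, a unit of mass can be placed arbitrarily far out at arbitrarily small cost
in `L^p(ℝ₊,ω)`. -/
lemma exists_unit_mass_of_not_bpInf {p : ℝ} {ω : ℝ → ℝ} (hp : 1 < p) (hω : IsWeight ω)
    (hB : ¬ BpInf p ω) {a C : ℝ} (ha : 0 < a) (hC : 0 < C) :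
    ∃ g : ℝ → ℝ, Integrable g ∧ IntegrableOn (fun t => |g t| ^ p * ω t) (Ioi 0) ∧
      (∀ t ≤ a, ∫ s in Ioi t, g s = 1) ∧
      ∫ t in Ioi (0 : ℝ), |g t| ^ p * ω t ≤ C ^ (1 - p) := by
  obtain ⟨b, hb⟩ := exists_le_integral_of_not_bpInf hω hB ha C
  set S := ∫ t in Ioc a b, ω t ^ (-1 / (p - 1)) with hS
  have hS0 : 0 < S := hC.trans hb
  have hp1 : 0 < p - 1 := by linarith
  have hσ := hω.integrableOn_rpow_Ioc (-1 / (p - 1)) ha b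
  have hpow : (fun t => |(Ioc a b).indicator (fun t => ω t ^ (-1 / (p - 1)) / S) t| ^ p * ω t) =
      (Ioc a b).indicator (fun t => ω t ^ (-1 / (p - 1)) / S ^ p) := by
    ext t
    by_cases ht : t ∈ Ioc a b
    · have h := hω.2 t (ha.trans ht.1)
      rw [indicator_of_mem ht, indicator_of_mem ht, abs_of_nonneg
        (div_nonneg (Real.rpow_nonneg h.le _) hS0.le), Real.div_rpow (Real.rpow_nonneg h.le _)
        hS0.le, ← Real.rpow_mul h.le, div_mul_eq_mul_div]
      congr 1
      nth_rewrite 2 [← Real.rpow_one (ω t)]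
      rw [← Real.rpow_add h]
      congr 1
      field_simp
      ring
    · rw [indicator_of_notMem ht, indicator_of_notMem ht, abs_zero,
        Real.zero_rpow (by linarith), zero_mul]
  refine ⟨(Ioc a b).indicator fun t => ω t ^ (-1 / (p - 1)) / S,
    IntegrableOn.integrable_indicator (hσ.div_const S) measurableSet_Ioc, ?_, fun t ht => ?_, ?_⟩
  · rw [hpow]
    exact (IntegrableOn.integrable_indicator (hσ.div_const _) measurableSet_Ioc).integrableOn
  · rw [setIntegral_indicator measurableSet_Ioc,
      inter_eq_right.2 (Ioc_subset_Ioi_self.trans (Ioi_subset_Ioi ht)), integral_div, ← hS,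
      div_self hS0.ne']
  · rw [hpow, setIntegral_indicator measurableSet_Ioc,
      inter_eq_right.2 (Ioc_subset_Ioi_self.trans (Ioi_subset_Ioi ha.le)), integral_div, ← hS]
    calc S / S ^ p = S ^ (1 - p) := by rw [Real.rpow_sub hS0, Real.rpow_one]
      _ ≤ C ^ (1 - p) := Real.rpow_le_rpow_of_nonpos hC hb.le (by linarith)

/-- `R^∞_{p,ω}(0)` is a closed subset of `D^{1,p}(ℝ₊,ω)` (with
respect to `L^p(ℝ₊,ω)` convergence of derivatives together with locally
uniform convergence on compact subsets of `(0,∞)`) iff `ω ∈ B_p(∞)`. -/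
theorem stmt16 (p : ℝ) (ω : ℝ → ℝ) (hp : 1 < p) (hω : IsWeight ω) :
    (∀ (u : ℕ → ℝ → ℝ) (u' : ℕ → ℝ → ℝ) (v v' : ℝ → ℝ),
      (∀ n, MemRInf p ω 0 (u n) (u' n)) → MemD p ω v v' →
      Tendsto (fun n => ∫ t in Set.Ioi (0:ℝ), |u' n t - v' t| ^ p * ω t)
        atTop (𝓝 0) →
      (∀ K : Set ℝ, K ⊆ Set.Ioi 0 → IsCompact K →
        TendstoUniformlyOn (fun n => u n) v atTop K) →
      MemRInf p ω 0 v v') ↔ BpInf p ω := by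
  refine ⟨fun hclosed => ?_, fun hB u u' v v' hu hv hLp huv =>
    memRInf_of_tendsto hp hω hB hu hv hLp fun t ht =>
      (huv {t} (singleton_subset_iff.2 ht) isCompact_singleton).tendsto_at (mem_singleton t)⟩
  by_contra hB
  choose g hg hgp hone hle using fun n : ℕ =>
    exists_unit_mass_of_not_bpInf hp hω hB (a := (n : ℝ) + 1) (C := (n : ℝ) + 1)
      (by positivity) (by positivity)
  have hmem : ∀ n, MemRInf p ω 0 (fun t => 0 - ∫ s in Ioi t, -g n s) (fun t => -g n t) :=
    fun n => memRInf_of_integrable 0 (hg n).neg (by simpa using hgp n)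
  have hp0 : p ≠ 0 := by linarith
  have hconst : MemD p ω (fun _ => 1) (fun _ => 0) :=
    ⟨fun _ _ _ _ => integrableOn_zero, fun _ _ _ _ => by simp,
      by simp [Real.zero_rpow hp0]⟩
  have hlim : Tendsto (fun n : ℕ => ((n : ℝ) + 1) ^ (1 - p)) atTop (𝓝 0) := by
    have h := (tendsto_rpow_neg_atTop (sub_pos.2 hp)).comp
      (tendsto_atTop_add_const_right atTop (1 : ℝ) tendsto_natCast_atTop_atTop)
    simpa only [neg_sub, Function.comp_def] using h
  have hcontra := (hclosed _ _ _ _ hmem hconst ?_ ?_).2 1 one_pos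
  · simp at hcontra
  · refine squeeze_zero (fun n => setIntegral_nonneg measurableSet_Ioi fun t ht =>
      mul_nonneg (Real.rpow_nonneg (abs_nonneg _) _) (hω.2 t ht).le) (fun n => ?_) hlim
    simpa using hle n
  · intro K _ hK
    obtain ⟨M, hM⟩ := hK.bddAbove
    obtain ⟨N, hN⟩ := exists_nat_ge M
    rw [Metric.tendstoUniformlyOn_iff]
    intro ε hε
    filter_upwards [eventually_ge_atTop N] with n hn t ht
    have hnN : (N : ℝ) ≤ n := Nat.cast_le.2 hn
    have htn : t ≤ (n : ℝ) + 1 := by linarith [hM ht]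
    simpa [integral_neg, hone n t htn] using hε

end
end
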